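/- arXiv:0909.5568 — 2 statements merged into one kernel-verified Lean document; each statement's English description precedes it below -/
import Mathlib

section
/- For every c-tuple λ = (λ_1, …, λ_c) ∈ k^c, the element u_λ = λ_1 x_1 + ⋯ + λ_c x_c of A satisfies u_λ^a = 0. -/
/-- The defining relations of the homogeneous quantum complete intersection with `c`
generators `x_i`, all exponents equal to `a`, and all commutators equal to `q`:
`x_i ^ a = 0` for all `i`, and `x_i x_j = q • (x_j x_i)` for `i < j`. -/
inductive QCIRel (k : Type) [Field k] (c a : ℕ) (q : k) :
    FreeAlgebra k (Fin c) → FreeAlgebra k (Fin c) → Prop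
  | pow (i : Fin c) : QCIRel k c a q (FreeAlgebra.ι k i ^ a) 0
  | comm (i j : Fin c) (hij : i < j) :
      QCIRel k c a q (FreeAlgebra.ι k i * FreeAlgebra.ι k j)
        (q • (FreeAlgebra.ι k j * FreeAlgebra.ι k i))

/-- The homogeneous quantum complete intersection `A = k⟨x_1,…,x_c⟩/(x_i^a, x_ix_j - q x_jx_i)`. -/
abbrev QCI (k : Type) [Field k] (c a : ℕ) (q : k) : Type := RingQuot (QCIRel k c a q)

/-- The image of the generator `x_i` in `A`. -/
noncomputable def Xgen (k : Type) [Field k] (c a : ℕ) (q : k) (i : Fin c) : QCI k c a q :=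
  RingQuot.mkAlgHom k (QCIRel k c a q) (FreeAlgebra.ι k i)

/-- The element `u_λ = λ_1 x_1 + ⋯ + λ_c x_c` of `A`. -/
noncomputable def uElt (k : Type) [Field k] (c a : ℕ) (q : k) (lam : Fin c → k) :
    QCI k c a q :=
  ∑ i, lam i • Xgen k c a q i

/-- The Gaussian binomial coefficients, defined by the `q`-Pascal recursion. -/
def gaussBinom {k : Type*} [Semiring k] (q : k) : ℕ → ℕ → k
  | _, 0 => 1
  | 0, _ + 1 => 0
  | n + 1, j + 1 => q ^ (j + 1) * gaussBinom q n (j + 1) + gaussBinom q n j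

section GaussBinom

variable {k : Type*} [CommRing k] (q : k)

@[simp] lemma gaussBinom_zero_right (n : ℕ) : gaussBinom q n 0 = 1 := by
  cases n <;> rfl

lemma gaussBinom_succ_succ (n j : ℕ) :
    gaussBinom q (n + 1) (j + 1) = q ^ (j + 1) * gaussBinom q n (j + 1) + gaussBinom q n j := rfl

lemma gaussBinom_eq_zero_of_lt {n j : ℕ} (h : n < j) : gaussBinom q n j = 0 := by
  induction n generalizing j with
  | zero => obtain ⟨j, rfl⟩ := Nat.exists_eq_succ_of_ne_zero h.ne'; rfl
  | succ n ih =>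
    obtain ⟨j, rfl⟩ := Nat.exists_eq_succ_of_ne_zero (Nat.ne_zero_of_lt h)
    rw [Nat.succ_eq_add_one, gaussBinom_succ_succ, ih (by omega), ih (by omega)]
    simp

@[simp] lemma gaussBinom_self (n : ℕ) : gaussBinom q n n = 1 := by
  induction n with
  | zero => rfl
  | succ n ih => simp [gaussBinom_succ_succ, gaussBinom_eq_zero_of_lt, ih]

lemma gaussBinom_succ_right (n j : ℕ) :
    q ^ j * (q ^ (j + 1) - 1) * gaussBinom q n (j + 1) = (q ^ n - q ^ j) * gaussBinom q n j := by
  induction n generalizing j with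
  | zero =>
    cases j with
    | zero => simp [gaussBinom]
    | succ j => simp [gaussBinom]
  | succ n ih =>
    cases j with
    | zero =>
      have h := ih 0
      simp only [gaussBinom_succ_succ, gaussBinom_zero_right] at h ⊢
      linear_combination q * h
    | succ j =>
      have h := ih j
      have h' := ih (j + 1)
      rw [gaussBinom_succ_succ, gaussBinom_succ_succ]
      linear_combination q ^ (j + 2) * h' + q * h

end GaussBinom

lemma IsPrimitiveRoot.gaussBinom_eq_zero {k : Type*} [CommRing k] [IsDomain k] {q : k} {b : ℕ}
    (hq : IsPrimitiveRoot q b) {j : ℕ} (hj : j ≠ 0) (hjb : j < b) : gaussBinom q b j = 0 := by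
  have hq0 : q ≠ 0 := hq.ne_zero (by omega)
  induction j with
  | zero => exact absurd rfl hj
  | succ j ih =>
    have h := gaussBinom_succ_right q b j
    have hR : (q ^ b - q ^ j) * gaussBinom q b j = 0 := by
      rcases eq_or_ne j 0 with rfl | hj0
      · simp [hq.pow_eq_one]
      · rw [ih hj0 (by omega), mul_zero]
    rw [hR] at h
    exact (mul_eq_zero.1 h).resolve_left <| mul_ne_zero (pow_ne_zero _ hq0) <|
      sub_ne_zero.2 <| hq.pow_ne_one_of_pos_of_lt hj hjb

section Algebra

variable {k A : Type*} [Field k] [Ring A] [Algebra k A]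

lemma mul_pow_of_mul_eq_smul {q : k} {x y : A} (h : x * y = q • (y * x)) (j : ℕ) :
    x * y ^ j = q ^ j • (y ^ j * x) := by
  induction j with
  | zero => simp
  | succ j ih =>
    rw [pow_succ, ← mul_assoc, ih, smul_mul_assoc, mul_assoc, h, mul_smul_comm, smul_smul,
      ← pow_succ, mul_assoc]

lemma pow_mul_pow_of_mul_eq_smul {q : k} {x y : A} (h : x * y = q • (y * x)) (i j : ℕ) :
    x ^ i * y ^ j = (q ^ j) ^ i • (y ^ j * x ^ i) := by
  induction i with
  | zero => simp
  | succ i ih =>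
    rw [pow_succ, mul_assoc, mul_pow_of_mul_eq_smul h, mul_smul_comm, ← mul_assoc, ih,
      smul_mul_assoc, smul_smul, mul_assoc, ← pow_succ']

/-- The noncommutative `q`-binomial theorem. -/
lemma add_pow_of_mul_eq_smul {q : k} {x y : A} (h : x * y = q • (y * x)) (n : ℕ) :
    (x + y) ^ n = ∑ j ∈ Finset.range (n + 1), gaussBinom q n j • (y ^ j * x ^ (n - j)) := by
  induction n with
  | zero => simp
  | succ n ih =>
    have hx : x * (x + y) ^ n =
        ∑ j ∈ Finset.range (n + 2), (q ^ j * gaussBinom q n j) • (y ^ j * x ^ (n + 1 - j)) := by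
      rw [Finset.sum_range_succ, gaussBinom_eq_zero_of_lt q (Nat.lt_succ_self n), mul_zero,
        zero_smul, add_zero, ih, Finset.mul_sum]
      refine Finset.sum_congr rfl fun j hj => ?_
      rw [Finset.mem_range] at hj
      rw [mul_smul_comm, ← mul_assoc, mul_pow_of_mul_eq_smul h, smul_mul_assoc, smul_smul,
        mul_assoc, ← pow_succ', mul_comm, show n - j + 1 = n + 1 - j by omega]
    have hy : y * (x + y) ^ n =
        ∑ j ∈ Finset.range (n + 1), gaussBinom q n j • (y ^ (j + 1) * x ^ (n - j)) := by
      rw [ih, Finset.mul_sum]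
      refine Finset.sum_congr rfl fun j _ => ?_
      rw [mul_smul_comm, ← mul_assoc, ← pow_succ']
    rw [pow_succ', add_mul, hx, hy, Finset.sum_range_succ', Finset.sum_range_succ' _ (n + 1),
      add_right_comm, ← Finset.sum_add_distrib]
    congr 1
    · refine Finset.sum_congr rfl fun j _ => ?_
      rw [Nat.add_sub_add_right, ← add_smul, gaussBinom_succ_succ]
    · simp

lemma IsPrimitiveRoot.add_pow_of_mul_eq_smul {q : k} {b : ℕ} (hq : IsPrimitiveRoot q b)
    (hb : b ≠ 0) {x y : A} (h : x * y = q • (y * x)) : (x + y) ^ b = x ^ b + y ^ b := by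
  obtain ⟨m, rfl⟩ := Nat.exists_eq_succ_of_ne_zero hb
  rw [_root_.add_pow_of_mul_eq_smul h, Finset.sum_range_succ, Finset.sum_range_succ',
    Finset.sum_eq_zero]
  · simp
  · intro j hj
    rw [Finset.mem_range] at hj
    rw [hq.gaussBinom_eq_zero (by omega) (by omega), zero_smul]

lemma IsPrimitiveRoot.sum_pow_of_mul_eq_smul {ι : Type*} [LinearOrder ι] {q : k} {b : ℕ}
    (hq : IsPrimitiveRoot q b) (hb : b ≠ 0) {x : ι → A}
    (h : ∀ i j, i < j → x i * x j = q • (x j * x i)) (s : Finset ι) :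
    (∑ i ∈ s, x i) ^ b = ∑ i ∈ s, x i ^ b := by
  induction s using Finset.induction_on_max with
  | empty => simp [hb]
  | insert m s hm ih =>
    have hms : m ∉ s := fun hmem => lt_irrefl _ (hm m hmem)
    rw [Finset.sum_insert hms, Finset.sum_insert hms, add_comm, hq.add_pow_of_mul_eq_smul hb, ih,
      add_comm]
    rw [Finset.sum_mul, Finset.mul_sum, Finset.smul_sum]
    exact Finset.sum_congr rfl fun i hi => h i m (hm i hi)

lemma sum_pow_char_of_commute {ι : Type*} (p : ℕ) [Fact p.Prime] [CharP k p] {x : ι → A}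
    (h : ∀ i j, Commute (x i) (x j)) (s : Finset ι) :
    (∑ i ∈ s, x i) ^ p = ∑ i ∈ s, x i ^ p := by
  classical
  have hp : p.Prime := Fact.out
  have hpA : (p : A) = 0 := by
    rw [← map_natCast (algebraMap k A), CharP.cast_eq_zero, map_zero]
  induction s using Finset.induction_on with
  | empty => simp [hp.ne_zero]
  | insert m s hms ih =>
    have hc : Commute (x m) (∑ i ∈ s, x i) := Commute.sum_right _ _ _ fun i _ => h m i
    obtain ⟨r, hr⟩ := hc.exists_add_pow_prime_eq hp
    rw [Finset.sum_insert hms, Finset.sum_insert hms, hr, hpA, ih]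
    simp

lemma IsPrimitiveRoot.commute_pow_of_mul_eq_smul {q : k} {b : ℕ} (hq : IsPrimitiveRoot q b)
    {x y : A} (h : x * y = q • (y * x)) : Commute (x ^ b) (y ^ b) := by
  rw [Commute, SemiconjBy, pow_mul_pow_of_mul_eq_smul h, hq.pow_eq_one, one_pow, one_smul]

end Algebra

lemma Xgen_pow (k : Type) [Field k] (c a : ℕ) (q : k) (i : Fin c) : Xgen k c a q i ^ a = 0 := by
  rw [Xgen, ← map_pow, RingQuot.mkAlgHom_rel k (QCIRel.pow i), map_zero]

lemma Xgen_mul_Xgen (k : Type) [Field k] (c a : ℕ) (q : k) {i j : Fin c} (hij : i < j) :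
    Xgen k c a q i * Xgen k c a q j = q • (Xgen k c a q j * Xgen k c a q i) := by
  simp only [Xgen]
  rw [← map_mul, RingQuot.mkAlgHom_rel k (QCIRel.comm i j hij), map_smul, map_mul]

/-- for every `λ ∈ k^c`, the element `u_λ` satisfies `u_λ ^ a = 0`. -/
theorem statement3 (k : Type) [Field k] [IsAlgClosed k] (c a : ℕ) (hc : 2 ≤ c) (ha : 2 ≤ a)
    (b : ℕ) (hb : b = if ringChar k = 0 then a else a / Nat.gcd a (ringChar k))
    (q : k) (hq : IsPrimitiveRoot q b) (lam : Fin c → k) :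
    uElt k c a q lam ^ a = 0 := by
  have hcomm : ∀ i j, i < j → (lam i • Xgen k c a q i) * (lam j • Xgen k c a q j) =
      q • ((lam j • Xgen k c a q j) * (lam i • Xgen k c a q i)) := by
    intro i j hij
    rw [smul_mul_smul_comm, smul_mul_smul_comm, Xgen_mul_Xgen k c a q hij, smul_comm,
      mul_comm (lam i)]
  have hzero : ∀ i, (lam i • Xgen k c a q i) ^ a = 0 := fun i => by
    rw [smul_pow, Xgen_pow, smul_zero]
  have hab : b = a ∨ (ringChar k).Prime ∧ a = b * ringChar k := by
    split_ifs at hb with h0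
    · exact Or.inl hb
    · have hp : (ringChar k).Prime := (CharP.char_is_prime_or_zero k (ringChar k)).resolve_right h0
      by_cases hd : ringChar k ∣ a
      · rw [Nat.gcd_eq_right hd] at hb
        exact Or.inr ⟨hp, by rw [hb, Nat.div_mul_cancel hd]⟩
      · have hg : Nat.gcd a (ringChar k) = 1 := ((Nat.Prime.coprime_iff_not_dvd hp).2 hd).symm
        rw [hg, Nat.div_one] at hb
        exact Or.inl hb
  have hb0 : b ≠ 0 := by
    rintro rfl
    rcases hab with h | ⟨-, h⟩ <;> omega
  have hsum := hq.sum_pow_of_mul_eq_smul hb0 hcomm Finset.univ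
  rw [uElt]
  rcases hab with rfl | ⟨hp, hpa⟩
  · rw [hsum]
    exact Finset.sum_eq_zero fun i _ => hzero i
  · have : Fact (ringChar k).Prime := ⟨hp⟩
    have hpow : ∀ z : QCI k c a q, z ^ a = (z ^ b) ^ ringChar k := fun z => by
      rw [← pow_mul, ← hpa]
    rw [hpow, hsum, sum_pow_char_of_commute (k := k) (ringChar k)]
    · exact Finset.sum_eq_zero fun i _ => by rw [← hpow, hzero]
    · intro i j
      rcases lt_trichotomy i j with hij | rfl | hij
      · exact hq.commute_pow_of_mul_eq_smul (hcomm i j hij)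
      · exact Commute.refl _
      · exact (hq.commute_pow_of_mul_eq_smul (hcomm j i hij)).symm
end

section
/- Suppose a = 2 and let λ ∈ k^c be nonzero. Then, as a module over the subalgebra k[u_λ] ≅ k[x]/(x^2), the left ideal A u_λ (with k[u_λ] acting by left multiplication) is isomorphic to the direct sum of 2^{c−1} copies of the one-dimensional module k[u_λ]/(u_λ). -/
theorem ExteriorAlgebra.exists_ι_mul_eq_mul_ι {R M : Type*} [CommRing R] [AddCommGroup M]
    [Module R M] (v : M) (x : ExteriorAlgebra R M) :
    ∃ y, ExteriorAlgebra.ι R v * x = y * ExteriorAlgebra.ι R v := by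
  induction x using ExteriorAlgebra.induction with
  | algebraMap r => exact ⟨algebraMap R _ r, (Algebra.commutes r _).symm⟩
  | ι w =>
    exact ⟨-ExteriorAlgebra.ι R w, by
      rw [neg_mul]; exact eq_neg_of_add_eq_zero_left (ExteriorAlgebra.ι_add_mul_swap v w)⟩
  | mul a b ha hb =>
    obtain ⟨a', ha⟩ := ha
    obtain ⟨b', hb⟩ := hb
    exact ⟨a' * b', by rw [← mul_assoc, ha, mul_assoc, hb, mul_assoc]⟩
  | add a b ha hb =>
    obtain ⟨a', ha⟩ := ha
    obtain ⟨b', hb⟩ := hb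
    exact ⟨a' + b', by rw [mul_add, ha, hb, add_mul]⟩

theorem ExteriorAlgebra.ι_mul_mul_ι_self {R M : Type*} [CommRing R] [AddCommGroup M]
    [Module R M] (v : M) (x : ExteriorAlgebra R M) :
    ExteriorAlgebra.ι R v * (x * ExteriorAlgebra.ι R v) = 0 := by
  obtain ⟨y, hy⟩ := ExteriorAlgebra.exists_ι_mul_eq_mul_ι v x
  rw [← mul_assoc, hy, mul_assoc, ExteriorAlgebra.ι_sq_zero, mul_zero]

/-- Right multiplication by a nonzero vector is exact on the exterior algebra. -/
theorem ExteriorAlgebra.exists_eq_mul_ι_of_mul_ι_eq_zero {K V : Type*} [Field K] [AddCommGroup V]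
    [Module K V] {v : V} (hv : v ≠ 0) {x : ExteriorAlgebra K V}
    (hx : x * ExteriorAlgebra.ι K v = 0) : ∃ y, y * ExteriorAlgebra.ι K v = x := by
  obtain ⟨d, hd⟩ := Module.Projective.exists_dual_ne_zero K hv
  have h : CliffordAlgebra.contractRight (x * ExteriorAlgebra.ι K v) d =
      d v • x - CliffordAlgebra.contractRight x d * ExteriorAlgebra.ι K v :=
    CliffordAlgebra.contractRight_mul_ι d v x
  rw [hx, map_zero, LinearMap.zero_apply] at h
  refine ⟨(d v)⁻¹ • CliffordAlgebra.contractRight x d, ?_⟩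
  rw [smul_mul_assoc, ← sub_eq_zero.mp h.symm, inv_smul_smul₀ hd]

theorem Finset.sum_mul_self_eq_zero_of_anticommute {ι R : Type*} [Semiring R]
    (s : Finset ι) (f : ι → R) (hsq : ∀ i, f i * f i = 0)
    (hanti : ∀ i j, f i * f j + f j * f i = 0) : (∑ i ∈ s, f i) * ∑ i ∈ s, f i = 0 := by
  classical
  induction s using Finset.induction_on with
  | empty => simp
  | insert a s ha ih =>
    have h : f a * ∑ i ∈ s, f i + (∑ i ∈ s, f i) * f a = 0 := by
      rw [Finset.mul_sum, Finset.sum_mul, ← Finset.sum_add_distrib]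
      exact Finset.sum_eq_zero fun i _ => hanti a i
    rw [Finset.sum_insert ha, add_mul, mul_add, mul_add, hsq, ih, zero_add, add_zero, h]

section ExteriorComparison

variable (k : Type) [Field k] (c : ℕ)

theorem Xgen_mul_self (i : Fin c) : Xgen k c 2 (-1) i * Xgen k c 2 (-1) i = 0 := by
  have h := RingQuot.mkAlgHom_rel k (QCIRel.pow (k := k) (a := 2) (q := -1) i)
  rwa [map_pow, map_zero, pow_two] at h

theorem Xgen_anticommute (i j : Fin c) :
    Xgen k c 2 (-1) i * Xgen k c 2 (-1) j + Xgen k c 2 (-1) j * Xgen k c 2 (-1) i = 0 := by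
  have key : ∀ i j : Fin c, i < j →
      Xgen k c 2 (-1) i * Xgen k c 2 (-1) j + Xgen k c 2 (-1) j * Xgen k c 2 (-1) i = 0 := by
    intro i j hij
    have h := RingQuot.mkAlgHom_rel k (QCIRel.comm (k := k) (a := 2) (q := -1) i j hij)
    rw [map_mul, map_smul, map_mul] at h
    have h' : Xgen k c 2 (-1) i * Xgen k c 2 (-1) j =
        (-1 : k) • (Xgen k c 2 (-1) j * Xgen k c 2 (-1) i) := h
    have hsum := add_smul (-1 : k) 1 (Xgen k c 2 (-1) j * Xgen k c 2 (-1) i)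
    rw [neg_add_cancel, zero_smul, one_smul] at hsum
    rw [h', ← hsum]
  rcases lt_trichotomy i j with h | rfl | h
  · exact key i j h
  · rw [Xgen_mul_self, add_zero]
  · rw [add_comm]; exact key j i h

theorem uElt_mul_self (lam : Fin c → k) : uElt k c 2 (-1) lam * uElt k c 2 (-1) lam = 0 := by
  refine Finset.sum_mul_self_eq_zero_of_anticommute _ _ (fun i => ?_) fun i j => ?_
  · rw [smul_mul_smul_comm, Xgen_mul_self, smul_zero]
  · rw [smul_mul_smul_comm, smul_mul_smul_comm, mul_comm (lam j), ← smul_add, Xgen_anticommute,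
      smul_zero]

/-- The algebra map from the quantum complete intersection with `a = 2`, `q = -1` to the exterior
algebra sending generators to the standard basis vectors. -/
noncomputable def QCI.toExterior : QCI k c 2 (-1) →ₐ[k] ExteriorAlgebra k (Fin c → k) :=
  RingQuot.liftAlgHom k ⟨FreeAlgebra.lift k fun i => ExteriorAlgebra.ι k (Pi.single i 1), by
    rintro _ _ (⟨i⟩ | ⟨i, j, hij⟩)
    · rw [map_pow, FreeAlgebra.lift_ι_apply, pow_two, ExteriorAlgebra.ι_sq_zero, map_zero]
    · rw [map_smul, map_mul, map_mul, FreeAlgebra.lift_ι_apply, FreeAlgebra.lift_ι_apply,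
        neg_one_smul]
      exact eq_neg_of_add_eq_zero_left (ExteriorAlgebra.ι_add_mul_swap _ _)⟩

theorem QCI.toExterior_Xgen (i : Fin c) :
    QCI.toExterior k c (Xgen k c 2 (-1) i) = ExteriorAlgebra.ι k (Pi.single i 1) := by
  rw [QCI.toExterior, Xgen, RingQuot.liftAlgHom_mkAlgHom_apply, FreeAlgebra.lift_ι_apply]

theorem QCI.toExterior_uElt (lam : Fin c → k) :
    QCI.toExterior k c (uElt k c 2 (-1) lam) = ExteriorAlgebra.ι k lam := by
  conv_rhs => rw [pi_eq_sum_univ' lam]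
  simp_rw [uElt, map_sum, map_smul, QCI.toExterior_Xgen]

/-- The algebra map from the exterior algebra to the quantum complete intersection with `a = 2`,
`q = -1`, sending a vector `lam` to `uElt lam`. -/
noncomputable def QCI.ofExterior : ExteriorAlgebra k (Fin c → k) →ₐ[k] QCI k c 2 (-1) :=
  ExteriorAlgebra.lift k ⟨Fintype.linearCombination k (Xgen k c 2 (-1)), uElt_mul_self k c⟩

theorem QCI.ofExterior_ι (lam : Fin c → k) :
    QCI.ofExterior k c (ExteriorAlgebra.ι k lam) = uElt k c 2 (-1) lam :=
  ExteriorAlgebra.lift_ι_apply k _ _ _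

/-- For `a = 2` and `q = -1` the quantum complete intersection is the exterior algebra. -/
noncomputable def QCI.equivExterior : QCI k c 2 (-1) ≃ₐ[k] ExteriorAlgebra k (Fin c → k) :=
  AlgEquiv.ofAlgHom (QCI.toExterior k c) (QCI.ofExterior k c)
    (ExteriorAlgebra.hom_ext (LinearMap.ext fun v =>
      (congrArg _ (QCI.ofExterior_ι k c v)).trans (QCI.toExterior_uElt k c v)))
    (RingQuot.ringQuot_ext' k _ _ (FreeAlgebra.hom_ext (funext fun i => by
      change QCI.ofExterior k c (QCI.toExterior k c (Xgen k c 2 (-1) i)) = Xgen k c 2 (-1) i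
      rw [QCI.toExterior_Xgen, QCI.ofExterior_ι, uElt]
      simp [Pi.single_apply])))

theorem QCI.equivExterior_uElt (lam : Fin c → k) :
    QCI.equivExterior k c (uElt k c 2 (-1) lam) = ExteriorAlgebra.ι k lam :=
  QCI.toExterior_uElt k c lam

/-- The monomial basis of the quantum complete intersection with `a = 2` and `q = -1`. -/
noncomputable def QCI.basis : Module.Basis (Finset (Fin c)) k (QCI k c 2 (-1)) :=
  (Pi.basisFun k (Fin c)).ExteriorAlgebra.map (QCI.equivExterior k c).symm.toLinearEquiv

theorem QCI.finrank_eq : Module.finrank k (QCI k c 2 (-1)) = 2 ^ c := by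
  rw [Module.finrank_eq_card_basis (QCI.basis k c), Fintype.card_finset, Fintype.card_fin]

instance QCI.finite : Module.Finite k (QCI k c 2 (-1)) := Module.Finite.of_basis (QCI.basis k c)

theorem uElt_mul_mul_uElt (lam : Fin c → k) (x : QCI k c 2 (-1)) :
    uElt k c 2 (-1) lam * (x * uElt k c 2 (-1) lam) = 0 := by
  apply (QCI.equivExterior k c).injective
  rw [map_mul, map_mul, QCI.equivExterior_uElt, ExteriorAlgebra.ι_mul_mul_ι_self, map_zero]

variable {k c}

theorem range_mulRight_uElt {lam : Fin c → k} (hlam : lam ≠ 0) :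
    LinearMap.range (LinearMap.mulRight k (uElt k c 2 (-1) lam)) =
      LinearMap.ker (LinearMap.mulRight k (uElt k c 2 (-1) lam)) := by
  ext x
  rw [LinearMap.mem_ker, LinearMap.mem_range, LinearMap.mulRight_apply]
  constructor
  · rintro ⟨y, rfl⟩
    rw [LinearMap.mulRight_apply, mul_assoc, uElt_mul_self, mul_zero]
  · intro hx
    obtain ⟨y, hy⟩ := ExteriorAlgebra.exists_eq_mul_ι_of_mul_ι_eq_zero hlam
      (x := QCI.equivExterior k c x)
      (by rw [← QCI.equivExterior_uElt, ← map_mul, hx, map_zero])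
    refine ⟨(QCI.equivExterior k c).symm y, (QCI.equivExterior k c).injective ?_⟩
    rw [LinearMap.mulRight_apply, map_mul, AlgEquiv.apply_symm_apply, QCI.equivExterior_uElt, hy]

theorem finrank_range_mulRight_uElt {lam : Fin c → k} (hlam : lam ≠ 0) :
    Module.finrank k (LinearMap.range (LinearMap.mulRight k (uElt k c 2 (-1) lam))) =
      2 ^ (c - 1) := by
  have h := LinearMap.finrank_range_add_finrank_ker (LinearMap.mulRight k (uElt k c 2 (-1) lam))
  rw [← range_mulRight_uElt hlam, QCI.finrank_eq] at h
  obtain _ | c := c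
  · exact absurd (Subsingleton.elim lam 0) hlam
  · rw [pow_succ] at h
    rw [Nat.add_sub_cancel]
    omega

end ExteriorComparison

theorem IsPrimitiveRoot.eq_neg_one_of_reduced_order {k : Type*} [Field k] {q : k}
    (hq : IsPrimitiveRoot q (if ringChar k = 0 then 2 else 2 / Nat.gcd 2 (ringChar k))) :
    q = -1 := by
  by_cases h2 : ringChar k = 2
  · have : CharP k 2 := ringChar.of_eq h2
    rw [h2] at hq
    rw [CharTwo.neg_eq]
    exact IsPrimitiveRoot.one_right_iff.mp (by simpa using hq)
  · refine IsPrimitiveRoot.eq_neg_one_of_two_right ?_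
    rcases CharP.char_is_prime_or_zero k (ringChar k) with hp | h0
    · have hg : Nat.gcd 2 (ringChar k) = 1 :=
        (Nat.coprime_primes Nat.prime_two hp).mpr (Ne.symm h2)
      simpa [hg] using hq
    · rwa [if_pos h0] at hq

/-- suppose `a = 2` and `λ ∈ k^c` is nonzero.  Then, as a module over the
subalgebra `k[u_λ] ≅ k[x]/(x^2)` (acting by left multiplication), the left ideal `A u_λ`
is isomorphic to the direct sum of `2^{c-1}` copies of the one-dimensional module
`k[u_λ]/(u_λ)`.  The latter module is the `k`-vector space `k` with `u_λ` acting as zero,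
so the isomorphism is expressed as a `k`-linear equivalence `A u_λ ≃ k^{2^{c-1}}`
intertwining the action of `u_λ` (by left multiplication) with the zero action; such an
equivalence is precisely a `k[u_λ]`-linear isomorphism `A u_λ ≅ (k[u_λ]/(u_λ))^{2^{c-1}}`. -/
theorem statement11 (k : Type) [Field k] [IsAlgClosed k] (c a : ℕ) (hc : 2 ≤ c)
    (ha : 2 ≤ a) (ha2 : a = 2)
    (b : ℕ) (hb : b = if ringChar k = 0 then a else a / Nat.gcd a (ringChar k))
    (q : k) (hq : IsPrimitiveRoot q b) (lam : Fin c → k) (hlam : lam ≠ 0) :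
    ∃ e : (LinearMap.range (LinearMap.toSpanSingleton (QCI k c a q) (QCI k c a q)
        (uElt k c a q lam))) ≃ₗ[k] (Fin (2 ^ (c - 1)) → k),
      ∀ m : LinearMap.range (LinearMap.toSpanSingleton (QCI k c a q) (QCI k c a q)
          (uElt k c a q lam)),
        e ⟨uElt k c a q lam • (m : QCI k c a q),
          (LinearMap.range (LinearMap.toSpanSingleton (QCI k c a q) (QCI k c a q)
            (uElt k c a q lam))).smul_mem _ m.2⟩ = 0 := by
  obtain rfl := ha2
  obtain rfl : q = -1 := IsPrimitiveRoot.eq_neg_one_of_reduced_order (hb ▸ hq)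
  have e : LinearMap.range (LinearMap.mulRight k (uElt k c 2 (-1) lam)) ≃ₗ[k]
      (Fin (2 ^ (c - 1)) → k) :=
    have := Module.Free.of_divisionRing k
      (LinearMap.range (LinearMap.mulRight k (uElt k c 2 (-1) lam)))
    LinearEquiv.ofFinrankEq _ _ (by rw [finrank_range_mulRight_uElt hlam, Module.finrank_fin_fun])
  refine ⟨e, ?_⟩
  rintro ⟨_, x, rfl⟩
  refine Eq.trans (congrArg e (Subtype.ext ?_)) (map_zero e)
  exact uElt_mul_mul_uElt k c lam x
end
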